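/- arXiv:1912.13353 — 2 statements merged into one kernel-verified Lean document; each statement's English description precedes it below -/
import Mathlib

section
/- Let K be a field, V a K-vector space, and S a set of pairwise commuting K-linear endomorphisms of V. Define F^{-1}V = 0 and, for i ≥ 0, F^i V = {v ∈ V : x_1 x_2 ⋯ x_{i+1} v = 0 for all x_1, …, x_{i+1} ∈ S}. Then: (a) for every x ∈ S and every i ≥ 0, x maps F^i V into F^{i-1} V; (b) if b : V → V is a K-linear map such that for every x ∈ S there exists a scalar c_x ∈ K with x ∘ b − b ∘ x = c_x · id_V, then b maps F^i V into F^{i+1} V for every i ≥ 0. -/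
/-- The Brylinski-type filtration attached to a set `S` of endomorphisms:
`F^{-1}V = 0` and, for `i ≥ 0`,
`F^i V = {v ∈ V : x₁ x₂ ⋯ x_{i+1} v = 0 for all x₁, …, x_{i+1} ∈ S}`. -/
def brylF {K V : Type*} [Field K] [AddCommGroup V] [Module K V]
    (S : Set (Module.End K V)) (i : ℤ) : Set V :=
  if i < 0 then {0}
  else {v | ∀ x : Fin (i.toNat + 1) → Module.End K V,
        (∀ j, x j ∈ S) → (List.ofFn x).prod v = 0}

def BrylP {K V : Type*} [Field K] [AddCommGroup V] [Module K V]
    (S : Set (Module.End K V)) (n : ℕ) (v : V) : Prop :=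
  ∀ l : List (Module.End K V), l.length = n → (∀ x ∈ l, x ∈ S) → l.prod v = 0

theorem mem_brylF_iff {K V : Type*} [Field K] [AddCommGroup V] [Module K V]
    (S : Set (Module.End K V)) (n : ℕ) (v : V) :
    v ∈ brylF S ((n : ℤ) - 1) ↔ BrylP S n v := by
  rcases n with _ | n
  · have : (((0 : ℕ) : ℤ) - 1) < 0 := by norm_num
    unfold brylF BrylP
    rw [if_pos this]
    simp
  · have e : (((n + 1 : ℕ) : ℤ) - 1) = (n : ℤ) := by push_cast; ring
    have h : ¬ ((n : ℤ) < 0) := by omega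
    rw [e]
    unfold brylF BrylP
    rw [if_neg h]
    constructor
    · intro hv l hl hS
      have hl' : l.length = (n : ℤ).toNat + 1 := by simpa using hl
      have key := hv (fun j => l.get (Fin.cast hl'.symm j)) (fun j => hS _ (List.get_mem _ _))
      have : List.ofFn (fun j => l.get (Fin.cast hl'.symm j)) = l := by
        rw [← List.ofFn_congr hl', List.ofFn_get]
      rwa [this] at key
    · intro hv x hx
      refine hv _ (by simp) ?_
      intro y hy
      obtain ⟨j, rfl⟩ := (List.mem_ofFn' _ _).1 hy
      exact hx j

theorem BrylP.lower {K V : Type*} [Field K] [AddCommGroup V] [Module K V]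
    {S : Set (Module.End K V)} {n : ℕ} {v : V} (h : BrylP S (n + 1) v)
    {x : Module.End K V} (hx : x ∈ S) : BrylP S n (x v) := by
  intro l hl hS
  have := h (l ++ [x]) (by simp [hl]) (by
    intro y hy
    rcases List.mem_append.1 hy with hy | hy
    · exact hS y hy
    · rw [List.mem_singleton.1 hy]; exact hx)
  simpa using this

theorem BrylP.raise {K V : Type*} [Field K] [AddCommGroup V] [Module K V]
    {S : Set (Module.End K V)} (b : Module.End K V)
    (hb : ∀ x ∈ S, ∃ c : K, x * b - b * x = c • (1 : Module.End K V)) (n : ℕ) :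
    ∀ v : V, BrylP S n v → BrylP S (n + 1) (b v) := by
  induction n with
  | zero =>
    intro v hv l _ _
    have : v = 0 := by simpa using hv [] rfl (by simp)
    simp [this]
  | succ n ih =>
    intro v hv l hl hS
    rcases List.eq_nil_or_concat l with rfl | ⟨m, x, rfl⟩
    · simp at hl
    · have hx : x ∈ S := hS x (by simp)
      have hm : ∀ y ∈ m, y ∈ S := fun y hy => hS y (by simp [hy])
      have hml : m.length = n + 1 := by simpa using hl
      obtain ⟨c, hc⟩ := hb x hx
      have e : x (b v) = b (x v) + c • v := by
        have := congrArg (fun f : Module.End K V => f v) hc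
        simp only [LinearMap.sub_apply, Module.End.mul_apply, LinearMap.smul_apply,
          Module.End.one_apply] at this
        rw [← this]; abel
      have h1 := ih (x v) (hv.lower hx) m hml hm
      have h2 := hv m hml hm
      simp [e, h1, h2]

/-- For `S` a set of pairwise commuting endomorphisms of `V`:
(a) every `x ∈ S` maps `F^i V` into `F^{i-1} V` for `i ≥ 0`;
(b) if `b` is a linear endomorphism such that for each `x ∈ S` the commutator
`x ∘ b − b ∘ x` is a scalar multiple of the identity, then `b` maps `F^i V`
into `F^{i+1} V` for every `i ≥ 0`. -/
theorem bryl_filtration_raise_lower {K V : Type*} [Field K] [AddCommGroup V] [Module K V]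
    (S : Set (Module.End K V))
    (hcomm : ∀ x ∈ S, ∀ y ∈ S, x * y = y * x) :
    (∀ x ∈ S, ∀ i : ℤ, 0 ≤ i → ∀ v ∈ brylF S i, x v ∈ brylF S (i - 1)) ∧
    (∀ b : Module.End K V,
      (∀ x ∈ S, ∃ c : K, x * b - b * x = c • (1 : Module.End K V)) →
      ∀ i : ℤ, 0 ≤ i → ∀ v ∈ brylF S i, b v ∈ brylF S (i + 1)) := by
  refine ⟨?_, ?_⟩
  · intro x hx i hi v hv
    obtain ⟨n, rfl⟩ := Int.eq_ofNat_of_zero_le hi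
    rw [mem_brylF_iff]
    have e : (n : ℤ) = ((n + 1 : ℕ) : ℤ) - 1 := by push_cast; ring
    rw [e, mem_brylF_iff] at hv
    exact hv.lower hx
  · intro b hb i hi v hv
    obtain ⟨n, rfl⟩ := Int.eq_ofNat_of_zero_le hi
    have e : (n : ℤ) = ((n + 1 : ℕ) : ℤ) - 1 := by push_cast; ring
    have e' : (n : ℤ) + 1 = ((n + 1 + 1 : ℕ) : ℤ) - 1 := by push_cast; ring
    rw [e, mem_brylF_iff] at hv
    rw [e', mem_brylF_iff]
    exact BrylP.raise b hb _ v hv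
end

section
/- Let K be a field, V a K-vector space, and S a set of pairwise commuting K-linear endomorphisms of V, with the filtration F^{-1}V = 0 and F^i V = {v ∈ V : x_1 x_2 ⋯ x_{i+1} v = 0 for all x_1, …, x_{i+1} ∈ S} for i ≥ 0. Suppose b_1, …, b_k are K-linear endomorphisms of V such that for every j ∈ {1,…,k} and every x ∈ S there exists a scalar c ∈ K with x ∘ b_j − b_j ∘ x = c · id_V. Then the composition b_1 ∘ b_2 ∘ ⋯ ∘ b_k maps F^i V into F^{i+k} V for every i ≥ 0; in particular, for any integer d ≥ k it maps F^i V into F^{i+d} V. -/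
/-- Recursive description of the filtration, shifted by one. -/
def brylG {K V : Type*} [Field K] [AddCommGroup V] [Module K V]
    (S : Set (Module.End K V)) : ℕ → V → Prop
  | 0 => fun v => v = 0
  | n + 1 => fun v => ∀ x ∈ S, brylG S n (x v)

section
variable {K V : Type*} [Field K] [AddCommGroup V] [Module K V] (S : Set (Module.End K V))

lemma brylG_iff (n : ℕ) : ∀ v : V, brylG S n v ↔
    ∀ x : Fin n → Module.End K V, (∀ j, x j ∈ S) → (List.ofFn x).prod v = 0 := by
  induction n with
  | zero => intro v; simp [brylG]
  | succ n ih =>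
    intro v
    constructor
    · intro h x hx
      rw [List.ofFn_succ', List.concat_eq_append, List.prod_append]
      have := (ih _).1 (h (x (Fin.last n)) (hx _)) (fun j => x j.castSucc) (fun j => hx _)
      simpa using this
    · intro h y hy
      refine (ih _).2 fun x hx => ?_
      have := h (Fin.snoc (α := fun _ => Module.End K V) x y) (by
        intro j
        refine Fin.lastCases ?_ (fun j => ?_) j
        · simpa using hy
        · simpa using hx j)
      rw [List.ofFn_succ', List.concat_eq_append, List.prod_append] at this
      simpa using this

lemma brylG_zero (n : ℕ) : brylG S n (0 : V) := by
  induction n with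
  | zero => rfl
  | succ n ih => intro x _; simpa using ih

lemma brylG_add (n : ℕ) : ∀ v w : V, brylG S n v → brylG S n w → brylG S n (v + w) := by
  induction n with
  | zero => intro v w hv hw; simp_all [brylG]
  | succ n ih => intro v w hv hw x hx; rw [map_add]; exact ih _ _ (hv x hx) (hw x hx)

lemma brylG_smul (n : ℕ) (c : K) : ∀ v : V, brylG S n v → brylG S n (c • v) := by
  induction n with
  | zero => intro v hv; simp_all [brylG]
  | succ n ih => intro v hv x hx; rw [map_smul]; exact ih _ (hv x hx)

lemma brylG_succ (n : ℕ) : ∀ v : V, brylG S n v → brylG S (n + 1) v := by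
  induction n with
  | zero => intro v hv; rw [show v = 0 from hv]; exact brylG_zero S _
  | succ n ih => intro v hv x hx; exact ih _ (hv x hx)

lemma brylG_mono {m n : ℕ} (h : m ≤ n) (v : V) (hv : brylG S m v) : brylG S n v := by
  induction h with
  | refl => exact hv
  | step _ ih => exact brylG_succ S _ v ih

lemma brylG_apply (b : Module.End K V)
    (hb : ∀ x ∈ S, ∃ c : K, x * b - b * x = c • (1 : Module.End K V)) (n : ℕ) :
    ∀ v : V, brylG S n v → brylG S (n + 1) (b v) := by
  induction n with
  | zero => intro v hv; rw [show v = 0 from hv, map_zero]; exact brylG_zero S _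
  | succ n ih =>
    intro v hv x hx
    obtain ⟨c, hc⟩ := hb x hx
    have h : x (b v) = b (x v) + c • v := by
      have := LinearMap.congr_fun hc v
      simp only [LinearMap.sub_apply, Module.End.mul_apply, LinearMap.smul_apply,
        Module.End.one_apply] at this
      rw [← this]; abel
    rw [h]
    exact brylG_add S _ _ _ (ih _ (hv x hx)) (brylG_smul S _ c v hv)

lemma brylG_prod (k : ℕ) : ∀ (b : Fin k → Module.End K V)
    (_ : ∀ j, ∀ x ∈ S, ∃ c : K, x * b j - b j * x = c • (1 : Module.End K V)) (n : ℕ)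
    (v : V), brylG S n v → brylG S (n + k) ((List.ofFn b).prod v) := by
  induction k with
  | zero => intro b _ n v hv; simpa using hv
  | succ k ih =>
    intro b hb n v hv
    rw [List.ofFn_succ, List.prod_cons, Module.End.mul_apply]
    exact brylG_apply S _ (hb 0) _ _ (ih _ (fun j => hb j.succ) n v hv)

lemma mem_brylF_iff_s2 (n : ℕ) (v : V) : v ∈ brylF S (n : ℤ) ↔ brylG S (n + 1) v := by
  rw [brylG_iff]
  unfold brylF
  rw [if_neg (by omega)]
  rfl

end

/-- If `b₁, …, b_k` are endomorphisms of `V` each of whose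
commutators with every element of `S` is a scalar multiple of the identity,
then the composition `b₁ ∘ b₂ ∘ ⋯ ∘ b_k` maps `F^i V` into `F^{i+k} V` for
every `i ≥ 0`; in particular, for any integer `d ≥ k` it maps `F^i V` into
`F^{i+d} V`. -/
theorem bryl_filtration_composition {K V : Type*} [Field K] [AddCommGroup V] [Module K V]
    (S : Set (Module.End K V))
    (hcomm : ∀ x ∈ S, ∀ y ∈ S, x * y = y * x)
    (k : ℕ) (b : Fin k → Module.End K V)
    (hb : ∀ j, ∀ x ∈ S, ∃ c : K, x * b j - b j * x = c • (1 : Module.End K V)) :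
    (∀ i : ℤ, 0 ≤ i → ∀ v ∈ brylF S i, (List.ofFn b).prod v ∈ brylF S (i + k)) ∧
    (∀ d : ℕ, k ≤ d →
      ∀ i : ℤ, 0 ≤ i → ∀ v ∈ brylF S i, (List.ofFn b).prod v ∈ brylF S (i + d)) := by
  have key : ∀ d : ℕ, k ≤ d →
      ∀ i : ℤ, 0 ≤ i → ∀ v ∈ brylF S i, (List.ofFn b).prod v ∈ brylF S (i + d) := by
    intro d hd i hi v hv
    lift i to ℕ using hi
    rw [mem_brylF_iff_s2] at hv
    rw [← Nat.cast_add, mem_brylF_iff_s2]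
    exact brylG_mono S (by omega) _ (brylG_prod S k b hb _ v hv)
  exact ⟨key k le_rfl, key⟩
end
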